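/- Concavity/convexity of the diatomic Bellman operator: let α ∈ (0,1), π ∈ Π, and 0 ≤ λ ≤ 1. For any Q, Q̃ : X×A → ℝ², the first component of T^π_α(λQ + (1−λ)Q̃) is ≥ λ times the first component of T^π_α Q plus (1−λ) times the first component of T^π_α Q̃ (pointwise), and the second component of T^π_α(λQ + (1−λ)Q̃) is ≤ λ times the second component of T^π_α Q plus (1−λ) times the second component of T^π_α Q̃ (pointwise). -/

import Mathlib

open MeasureTheory ProbabilityTheory Finset Set

noncomputable section

/-- Quantile (generalized inverse distribution) function of a measure on `ℝ`. -/
def quantileFn (ν : Measure ℝ) (τ : ℝ) : ℝ :=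
  sInf {z : ℝ | τ ≤ cdf ν z}

/-- Left average value-at-risk at level `α`. -/
def avarLeft (α : ℝ) (ν : Measure ℝ) : ℝ :=
  (1 / α) * ∫ τ in (0:ℝ)..α, quantileFn ν τ

/-- Right average value-at-risk at level `1 - α`. -/
def avarRight (α : ℝ) (ν : Measure ℝ) : ℝ :=
  (1 / (1 - α)) * ∫ τ in α..(1:ℝ), quantileFn ν τ

/-- A measure on `ℝ` with bounded support. -/
def HasBoundedSupport (ν : Measure ℝ) : Prop :=
  ∃ a b : ℝ, ν (Set.Icc a b)ᶜ = 0

/-- Finite Markov decision process with fixed state and action spaces. -/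
structure MDP (X A : Type) [Fintype X] [Fintype A] where
  P : X → A → X → ℝ
  r : X → A → X → ℝ
  γ : ℝ
  P_nonneg : ∀ x a x', 0 ≤ P x a x'
  P_sum_one : ∀ x a, ∑ x', P x a x' = 1
  γ_nonneg : 0 ≤ γ
  γ_lt_one : γ < 1

variable {X A : Type} [Fintype X] [Fintype A]

/-- A stationary Markovian policy. -/
def IsPolicy (π : X → A → ℝ) : Prop :=
  (∀ x a, 0 ≤ π x a) ∧ ∀ x, ∑ a, π x a = 1

/-- The discrete measure `(T^π D_{α,Q})^{(x,a)}`. -/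
def diatomicMeasure (M : MDP X A) (α : ℝ) (π : X → A → ℝ)
    (Q : X → A → ℝ × ℝ) (x : X) (a : A) : Measure ℝ :=
  ∑ x' : X, ∑ a' : A, ENNReal.ofReal (M.P x a x' * π x' a') •
    (ENNReal.ofReal α • Measure.dirac (M.r x a x' + M.γ * (Q x' a').1)
      + ENNReal.ofReal (1 - α) • Measure.dirac (M.r x a x' + M.γ * (Q x' a').2))

/-- The diatomic Bellman operator `T^π_α`. -/
def diatomicT (M : MDP X A) (α : ℝ) (π : X → A → ℝ)
    (Q : X → A → ℝ × ℝ) : X → A → ℝ × ℝ :=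
  fun x a => (avarLeft α (diatomicMeasure M α π Q x a),
              avarRight α (diatomicMeasure M α π Q x a))

theorem quantileFn_le_iff (ν : Measure ℝ) {τ : ℝ} (hτ : τ ∈ Set.Ioo (0:ℝ) 1) (z : ℝ) :
    quantileFn ν τ ≤ z ↔ τ ≤ cdf ν z := by
  have hne : {z : ℝ | τ ≤ cdf ν z}.Nonempty :=
    ((tendsto_cdf_atTop ν).eventually (eventually_ge_nhds hτ.2)).exists
  obtain ⟨b, hb⟩ := ((tendsto_cdf_atBot ν).eventually (eventually_lt_nhds hτ.1)).exists
  have hbdd : BddBelow {z : ℝ | τ ≤ cdf ν z} := by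
    refine ⟨b, fun z hz => ?_⟩
    by_contra! hzb
    exact absurd (hz.trans (monotone_cdf ν hzb.le)) (not_le.2 hb)
  refine ⟨fun h => ?_, fun h => csInf_le hbdd h⟩
  have hright : Filter.Tendsto (cdf ν) (nhdsWithin z (Set.Ioi z)) (nhds (cdf ν z)) :=
    ((cdf ν).right_continuous z).mono_left (nhdsWithin_mono z Set.Ioi_subset_Ici_self)
  refine ge_of_tendsto hright ?_
  filter_upwards [self_mem_nhdsWithin] with y hy
  obtain ⟨w, hw, hwy⟩ := exists_lt_of_csInf_lt hne (lt_of_le_of_lt h hy)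
  exact le_trans hw (monotone_cdf ν hwy.le)

theorem monotoneOn_quantileFn (ν : Measure ℝ) :
    MonotoneOn (quantileFn ν) (Set.Ioo (0:ℝ) 1) := fun _ hs _ ht hst =>
  (quantileFn_le_iff ν hs _).2 (hst.trans ((quantileFn_le_iff ν ht _).1 le_rfl))

theorem aemeasurable_quantileFn (ν : Measure ℝ) :
    AEMeasurable (quantileFn ν) (volume.restrict (Set.Ioo (0:ℝ) 1)) :=
  aemeasurable_restrict_of_monotoneOn measurableSet_Ioo (monotoneOn_quantileFn ν)

theorem map_quantileFn (ν : Measure ℝ) [IsProbabilityMeasure ν] :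
    (volume.restrict (Set.Ioo (0:ℝ) 1)).map (quantileFn ν) = ν := by
  have : IsProbabilityMeasure (volume.restrict (Set.Ioo (0:ℝ) 1)) := ⟨by simp⟩
  have := Measure.isProbabilityMeasure_map (aemeasurable_quantileFn ν)
  refine Measure.ext_of_Iic _ _ fun z => ?_
  rw [Measure.map_apply_of_aemeasurable (aemeasurable_quantileFn ν) measurableSet_Iic,
    ← ofReal_cdf ν z, Measure.restrict_apply₀'
      measurableSet_Ioo.nullMeasurableSet]
  have hset : quantileFn ν ⁻¹' Set.Iic z ∩ Set.Ioo (0:ℝ) 1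
      = Set.Ioo (0:ℝ) 1 ∩ Set.Iic (cdf ν z) := by
    ext τ
    simp only [Set.mem_inter_iff, Set.mem_preimage, Set.mem_Iic]
    exact ⟨fun h => ⟨h.2, (quantileFn_le_iff ν h.2 z).1 h.1⟩,
      fun h => ⟨(quantileFn_le_iff ν h.1 z).2 h.2, h.1⟩⟩
  rw [hset]
  refine le_antisymm ?_ ?_
  · calc volume (Set.Ioo (0:ℝ) 1 ∩ Set.Iic (cdf ν z))
        ≤ volume (Set.Icc 0 (cdf ν z)) := measure_mono fun τ h => ⟨h.1.1.le, h.2⟩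
      _ = _ := by simp
  · calc ENNReal.ofReal (cdf ν z) = volume (Set.Ioo 0 (cdf ν z)) := by simp
      _ ≤ volume (Set.Ioo (0:ℝ) 1 ∩ Set.Iic (cdf ν z)) := measure_mono fun τ h =>
        ⟨⟨h.1, h.2.trans_le (cdf_le_one ν z)⟩, h.2.le⟩

theorem integral_comp_quantileFn (ν : Measure ℝ) [IsProbabilityMeasure ν] {g : ℝ → ℝ}
    (hg : Continuous g) :
    ∫ τ in Set.Ioo (0:ℝ) 1, g (quantileFn ν τ) = ∫ x, g x ∂ν := by
  conv_rhs => rw [← map_quantileFn ν]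
  exact (integral_map (aemeasurable_quantileFn ν) hg.aestronglyMeasurable).symm

theorem integrableOn_comp_quantileFn (ν : Measure ℝ) [IsProbabilityMeasure ν] {g : ℝ → ℝ}
    (hg : Continuous g) (hi : Integrable g ν) :
    IntegrableOn (fun τ => g (quantileFn ν τ)) (Set.Ioo (0:ℝ) 1) := by
  rw [← map_quantileFn ν] at hi
  exact (integrable_map_measure hg.aestronglyMeasurable (aemeasurable_quantileFn ν)).1 hi

/-- The integral over `(0,1)` splits at `α`, for `g ∘ quantileFn ν`. -/
theorem integral_comp_quantileFn_split (ν : Measure ℝ) [IsProbabilityMeasure ν] {α : ℝ}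
    (hα : α ∈ Set.Ioo (0:ℝ) 1) {g : ℝ → ℝ} (hg : Continuous g) (hi : Integrable g ν) :
    IntervalIntegrable (fun τ => g (quantileFn ν τ)) volume 0 α ∧
    IntervalIntegrable (fun τ => g (quantileFn ν τ)) volume α 1 ∧
    (∫ τ in (0:ℝ)..α, g (quantileFn ν τ)) + ∫ τ in α..(1:ℝ), g (quantileFn ν τ)
      = ∫ x, g x ∂ν := by
  have h01 : IntervalIntegrable (fun τ => g (quantileFn ν τ)) volume 0 1 := by
    rw [intervalIntegrable_iff_integrableOn_Ioo_of_le zero_le_one]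
    exact integrableOn_comp_quantileFn ν hg hi
  have h0 : IntervalIntegrable (fun τ => g (quantileFn ν τ)) volume 0 α :=
    h01.mono_set (by
      rw [Set.uIcc_of_le hα.1.le, Set.uIcc_of_le zero_le_one]
      exact Set.Icc_subset_Icc_right hα.2.le)
  have h1 : IntervalIntegrable (fun τ => g (quantileFn ν τ)) volume α 1 :=
    h01.mono_set (by
      rw [Set.uIcc_of_le hα.2.le, Set.uIcc_of_le zero_le_one]
      exact Set.Icc_subset_Icc_left hα.1.le)
  refine ⟨h0, h1, ?_⟩
  rw [intervalIntegral.integral_add_adjacent_intervals h0 h1,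
    intervalIntegral.integral_of_le zero_le_one, integral_Ioc_eq_integral_Ioo,
    integral_comp_quantileFn ν hg]

theorem integrable_posPart_sub (ν : Measure ℝ) [IsProbabilityMeasure ν]
    (hi : Integrable (fun x : ℝ => x) ν) (q : ℝ) :
    Integrable (fun x => max (q - x) 0) ν ∧ Integrable (fun x => max (x - q) 0) ν :=
  ⟨((integrable_const q).sub hi).pos_part, (hi.sub (integrable_const q)).pos_part⟩

theorem sub_integral_le_integral_quantileFn (ν : Measure ℝ) [IsProbabilityMeasure ν]
    (hi : Integrable (fun x : ℝ => x) ν) {α : ℝ} (hα : α ∈ Set.Ioo (0:ℝ) 1) (q : ℝ) :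
    α * q - ∫ x, max (q - x) 0 ∂ν ≤ ∫ τ in (0:ℝ)..α, quantileFn ν τ := by
  obtain ⟨h0, h1, hsum⟩ := integral_comp_quantileFn_split ν hα (g := fun x => max (q - x) 0)
    (by fun_prop) (integrable_posPart_sub ν hi q).1
  obtain ⟨k0, -, -⟩ := integral_comp_quantileFn_split ν hα continuous_id hi
  have hpos : 0 ≤ ∫ τ in α..(1:ℝ), max (q - quantileFn ν τ) 0 :=
    intervalIntegral.integral_nonneg hα.2.le fun _ _ => le_max_right _ _
  have hle : ∫ τ in (0:ℝ)..α, (q - max (q - quantileFn ν τ) 0) ≤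
      ∫ τ in (0:ℝ)..α, quantileFn ν τ :=
    intervalIntegral.integral_mono_on hα.1.le (intervalIntegrable_const.sub h0) k0
      fun τ _ => by linarith [le_max_left (q - quantileFn ν τ) 0]
  rw [intervalIntegral.integral_sub intervalIntegrable_const h0,
    intervalIntegral.integral_const, smul_eq_mul, sub_zero] at hle
  linarith

theorem integral_quantileFn_eq_sub_integral (ν : Measure ℝ) [IsProbabilityMeasure ν]
    (hi : Integrable (fun x : ℝ => x) ν) {α : ℝ} (hα : α ∈ Set.Ioo (0:ℝ) 1) :
    ∫ τ in (0:ℝ)..α, quantileFn ν τ =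
      α * quantileFn ν α - ∫ x, max (quantileFn ν α - x) 0 ∂ν := by
  set q := quantileFn ν α
  obtain ⟨h0, h1, hsum⟩ := integral_comp_quantileFn_split ν hα (g := fun x => max (q - x) 0)
    (by fun_prop) (integrable_posPart_sub ν hi q).1
  have hzero : ∫ τ in α..(1:ℝ), max (q - quantileFn ν τ) 0 = 0 := by
    rw [intervalIntegral.integral_of_le hα.2.le, integral_Ioc_eq_integral_Ioo]
    refine setIntegral_eq_zero_of_forall_eq_zero fun τ hτ => max_eq_right ?_
    linarith [monotoneOn_quantileFn ν hα ⟨hα.1.trans hτ.1, hτ.2⟩ hτ.1.le]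
  have heq : ∫ τ in (0:ℝ)..α, quantileFn ν τ =
      ∫ τ in (0:ℝ)..α, (q - max (q - quantileFn ν τ) 0) := by
    rw [intervalIntegral.integral_of_le hα.1.le, intervalIntegral.integral_of_le hα.1.le]
    refine setIntegral_congr_fun measurableSet_Ioc fun τ hτ => ?_
    have := monotoneOn_quantileFn ν ⟨hτ.1, hτ.2.trans_lt hα.2⟩ hα hτ.2
    rw [max_eq_left (by linarith)]
    ring
  rw [intervalIntegral.integral_sub intervalIntegrable_const h0,
    intervalIntegral.integral_const, smul_eq_mul, sub_zero] at heq
  linarith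

/-- The upper quantile integral in terms of the lower one, with the mean rewritten through
the positive parts at level `q`. -/
theorem integral_quantileFn_upper_eq (ν : Measure ℝ) [IsProbabilityMeasure ν]
    (hi : Integrable (fun x : ℝ => x) ν) {α : ℝ} (hα : α ∈ Set.Ioo (0:ℝ) 1) (q : ℝ) :
    ∫ τ in α..(1:ℝ), quantileFn ν τ =
      q + ∫ x, max (x - q) 0 ∂ν - ∫ x, max (q - x) 0 ∂ν -
        ∫ τ in (0:ℝ)..α, quantileFn ν τ := by
  obtain ⟨-, -, hmean⟩ := integral_comp_quantileFn_split ν hα continuous_id hi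
  have hsub := integral_sub (integrable_posPart_sub ν hi q).2 (integrable_posPart_sub ν hi q).1
  have hpt : ∀ x : ℝ, max (x - q) 0 - max (q - x) 0 = x - q := fun x => by
    rcases le_total x q with h | h
    · rw [max_eq_right (by linarith), max_eq_left (by linarith)]; ring
    · rw [max_eq_left (by linarith), max_eq_right (by linarith)]; ring
  simp only [hpt] at hsub
  rw [integral_sub hi (integrable_const q), integral_const, probReal_univ, one_smul] at hsub
  simp only [id] at hmean
  linarith

theorem integral_quantileFn_upper_le (ν : Measure ℝ) [IsProbabilityMeasure ν]
    (hi : Integrable (fun x : ℝ => x) ν) {α : ℝ} (hα : α ∈ Set.Ioo (0:ℝ) 1) (q : ℝ) :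
    ∫ τ in α..(1:ℝ), quantileFn ν τ ≤ (1 - α) * q + ∫ x, max (x - q) 0 ∂ν := by
  linarith [integral_quantileFn_upper_eq ν hi hα q, sub_integral_le_integral_quantileFn ν hi hα q]

theorem integral_quantileFn_upper_eq_add_integral (ν : Measure ℝ) [IsProbabilityMeasure ν]
    (hi : Integrable (fun x : ℝ => x) ν) {α : ℝ} (hα : α ∈ Set.Ioo (0:ℝ) 1) :
    ∫ τ in α..(1:ℝ), quantileFn ν τ =
      (1 - α) * quantileFn ν α + ∫ x, max (x - quantileFn ν α) 0 ∂ν := by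
  linarith [integral_quantileFn_upper_eq ν hi hα (quantileFn ν α),
    integral_quantileFn_eq_sub_integral ν hi hα]

theorem isProbabilityMeasure_diatomicMeasure (M : MDP X A) {α : ℝ} (hα : α ∈ Set.Ioo (0:ℝ) 1)
    {π : X → A → ℝ} (hπ : IsPolicy π) (Q : X → A → ℝ × ℝ) (x : X) (a : A) :
    IsProbabilityMeasure (diatomicMeasure M α π Q x a) := by
  have hw : ENNReal.ofReal α + ENNReal.ofReal (1 - α) = 1 := by
    rw [← ENNReal.ofReal_add hα.1.le (by linarith [hα.2])]; simp
  refine ⟨?_⟩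
  simp only [diatomicMeasure, Measure.coe_finsetSum, Finset.sum_apply, Measure.smul_apply,
    Measure.add_apply, measure_univ, smul_eq_mul, mul_one, hw]
  rw [Finset.sum_congr rfl fun x' _ => (ENNReal.ofReal_sum_of_nonneg fun a' _ =>
      mul_nonneg (M.P_nonneg x a x') (hπ.1 x' a')).symm,
    ← ENNReal.ofReal_sum_of_nonneg fun x' _ => Finset.sum_nonneg fun a' _ =>
      mul_nonneg (M.P_nonneg x a x') (hπ.1 x' a')]
  simp [← Finset.mul_sum, hπ.2, M.P_sum_one]

theorem integrable_diatomicMeasure (M : MDP X A) (α : ℝ) (π : X → A → ℝ)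
    (Q : X → A → ℝ × ℝ) (x : X) (a : A) (g : ℝ → ℝ) :
    Integrable g (diatomicMeasure M α π Q x a) := by
  have hd : ∀ y : ℝ, Integrable g (Measure.dirac y) := fun y => integrable_dirac (by simp)
  simp only [diatomicMeasure, integrable_finsetSum_measure]
  exact fun x' _ a' _ => (((hd _).smul_measure ENNReal.ofReal_ne_top).add_measure
    ((hd _).smul_measure ENNReal.ofReal_ne_top)).smul_measure ENNReal.ofReal_ne_top

theorem integral_diatomicMeasure (M : MDP X A) {α : ℝ} (hα : α ∈ Set.Ioo (0:ℝ) 1)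
    {π : X → A → ℝ} (hπ : IsPolicy π) (Q : X → A → ℝ × ℝ) (x : X) (a : A) (g : ℝ → ℝ) :
    ∫ y, g y ∂(diatomicMeasure M α π Q x a) =
      ∑ x', ∑ a', M.P x a x' * π x' a' *
        (α * g (M.r x a x' + M.γ * (Q x' a').1) +
          (1 - α) * g (M.r x a x' + M.γ * (Q x' a').2)) := by
  have hd : ∀ (c : ℝ) (y : ℝ), Integrable g (ENNReal.ofReal c • Measure.dirac y) :=
    fun c y => (integrable_dirac (by simp)).smul_measure ENNReal.ofReal_ne_top
  have hw : ∀ x' a', Integrable g (ENNReal.ofReal (M.P x a x' * π x' a') •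
      (ENNReal.ofReal α • Measure.dirac (M.r x a x' + M.γ * (Q x' a').1)
      + ENNReal.ofReal (1 - α) • Measure.dirac (M.r x a x' + M.γ * (Q x' a').2))) :=
    fun x' a' => ((hd _ _).add_measure (hd _ _)).smul_measure ENNReal.ofReal_ne_top
  rw [diatomicMeasure, integral_finsetSum_measure fun x' _ =>
    integrable_finsetSum_measure.2 fun a' _ => hw x' a']
  refine Finset.sum_congr rfl fun x' _ => ?_
  rw [integral_finsetSum_measure fun a' _ => hw x' a']
  refine Finset.sum_congr rfl fun a' _ => ?_
  rw [integral_smul_measure, integral_add_measure (hd _ _) (hd _ _), integral_smul_measure,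
    integral_smul_measure, integral_dirac, integral_dirac,
    ENNReal.toReal_ofReal (mul_nonneg (M.P_nonneg x a x') (hπ.1 x' a')),
    ENNReal.toReal_ofReal hα.1.le, ENNReal.toReal_ofReal (by linarith [hα.2])]
  simp only [smul_eq_mul]

theorem integral_diatomicMeasure_convexComb_le (M : MDP X A) {α : ℝ}
    (hα : α ∈ Set.Ioo (0:ℝ) 1) {π : X → A → ℝ} (hπ : IsPolicy π) (lam : ℝ)
    (Q Qt : X → A → ℝ × ℝ) (x : X) (a : A) {φ φ₁ φ₂ : ℝ → ℝ}
    (hφ : ∀ u v, φ (lam * u + (1 - lam) * v) ≤ lam * φ₁ u + (1 - lam) * φ₂ v) :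
    ∫ y, φ y ∂(diatomicMeasure M α π
        (fun x a => (lam * (Q x a).1 + (1 - lam) * (Qt x a).1,
                     lam * (Q x a).2 + (1 - lam) * (Qt x a).2)) x a) ≤
      lam * ∫ y, φ₁ y ∂(diatomicMeasure M α π Q x a) +
        (1 - lam) * ∫ y, φ₂ y ∂(diatomicMeasure M α π Qt x a) := by
  have hpt : ∀ r u v, φ (r + M.γ * (lam * u + (1 - lam) * v)) ≤
      lam * φ₁ (r + M.γ * u) + (1 - lam) * φ₂ (r + M.γ * v) := fun r u v => by
    have h := hφ (r + M.γ * u) (r + M.γ * v)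
    rwa [show lam * (r + M.γ * u) + (1 - lam) * (r + M.γ * v)
      = r + M.γ * (lam * u + (1 - lam) * v) by ring] at h
  simp only [integral_diatomicMeasure M hα hπ, Finset.mul_sum, ← Finset.sum_add_distrib]
  refine Finset.sum_le_sum fun x' _ => Finset.sum_le_sum fun a' _ => ?_
  have h1 := mul_le_mul_of_nonneg_left (hpt (M.r x a x') (Q x' a').1 (Qt x' a').1) hα.1.le
  have h2 := mul_le_mul_of_nonneg_left (hpt (M.r x a x') (Q x' a').2 (Qt x' a').2)
    (sub_nonneg.2 hα.2.le)
  have h3 := mul_le_mul_of_nonneg_left (add_le_add h1 h2)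
    (mul_nonneg (M.P_nonneg x a x') (hπ.1 x' a'))
  refine h3.trans (le_of_eq ?_)
  ring

theorem posPart_convexComb_le {lam : ℝ} (hlam : lam ∈ Set.Icc (0:ℝ) 1) (u v : ℝ) :
    max (lam * u + (1 - lam) * v) 0 ≤ lam * max u 0 + (1 - lam) * max v 0 := by
  have h0 := hlam.1
  have h1 := sub_nonneg.2 hlam.2
  refine max_le (add_le_add ?_ ?_) (by positivity)
  · exact mul_le_mul_of_nonneg_left (le_max_left _ _) h0
  · exact mul_le_mul_of_nonneg_left (le_max_left _ _) h1

theorem stmt5 (M : MDP X A) (α : ℝ) (hα : α ∈ Set.Ioo (0:ℝ) 1)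
    (π : X → A → ℝ) (hπ : IsPolicy π)
    (lam : ℝ) (hlam : lam ∈ Set.Icc (0:ℝ) 1)
    (Q Qt : X → A → ℝ × ℝ) :
    ∀ x a,
      lam * (diatomicT M α π Q x a).1 + (1 - lam) * (diatomicT M α π Qt x a).1 ≤
        (diatomicT M α π
          (fun x a => (lam * (Q x a).1 + (1 - lam) * (Qt x a).1,
                       lam * (Q x a).2 + (1 - lam) * (Qt x a).2)) x a).1 ∧
      (diatomicT M α π
          (fun x a => (lam * (Q x a).1 + (1 - lam) * (Qt x a).1,
                       lam * (Q x a).2 + (1 - lam) * (Qt x a).2)) x a).2 ≤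
        lam * (diatomicT M α π Q x a).2 + (1 - lam) * (diatomicT M α π Qt x a).2 := by
  intro x a
  set Ql : X → A → ℝ × ℝ := fun x a =>
    (lam * (Q x a).1 + (1 - lam) * (Qt x a).1, lam * (Q x a).2 + (1 - lam) * (Qt x a).2)
  have := isProbabilityMeasure_diatomicMeasure M hα hπ Q x a
  have := isProbabilityMeasure_diatomicMeasure M hα hπ Qt x a
  have := isProbabilityMeasure_diatomicMeasure M hα hπ Ql x a
  have hi := integrable_diatomicMeasure M α π Q x a fun y => y
  have hit := integrable_diatomicMeasure M α π Qt x a fun y => y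
  have hil := integrable_diatomicMeasure M α π Ql x a fun y => y
  set q₁ := quantileFn (diatomicMeasure M α π Q x a) α
  set q₂ := quantileFn (diatomicMeasure M α π Qt x a) α
  simp only [diatomicT, avarLeft, avarRight]
  constructor
  · have h1 := integral_quantileFn_eq_sub_integral _ hi hα
    have h2 := integral_quantileFn_eq_sub_integral _ hit hα
    have h3 := sub_integral_le_integral_quantileFn _ hil hα (lam * q₁ + (1 - lam) * q₂)
    have h4 := integral_diatomicMeasure_convexComb_le M hα hπ lam Q Qt x a
      (φ := fun y => max (lam * q₁ + (1 - lam) * q₂ - y) 0)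
      (φ₁ := fun y => max (q₁ - y) 0) (φ₂ := fun y => max (q₂ - y) 0) fun u v => by
        convert posPart_convexComb_le hlam (q₁ - u) (q₂ - v) using 2
        ring
    rw [mul_left_comm lam, mul_left_comm (1 - lam), ← mul_add, h1, h2]
    refine mul_le_mul_of_nonneg_left ?_ (one_div_nonneg.2 hα.1.le)
    linarith
  · have h1 := integral_quantileFn_upper_eq_add_integral _ hi hα
    have h2 := integral_quantileFn_upper_eq_add_integral _ hit hα
    have h3 := integral_quantileFn_upper_le _ hil hα (lam * q₁ + (1 - lam) * q₂)
    have h4 := integral_diatomicMeasure_convexComb_le M hα hπ lam Q Qt x a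
      (φ := fun y => max (y - (lam * q₁ + (1 - lam) * q₂)) 0)
      (φ₁ := fun y => max (y - q₁) 0) (φ₂ := fun y => max (y - q₂) 0) fun u v => by
        convert posPart_convexComb_le hlam (u - q₁) (v - q₂) using 2
        ring
    rw [mul_left_comm lam, mul_left_comm (1 - lam), ← mul_add, h1, h2]
    refine mul_le_mul_of_nonneg_left ?_ (one_div_nonneg.2 (sub_nonneg.2 hα.2.le))
    linarith

end
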